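/- arXiv:1002.4604 — 3 statements merged into one kernel-verified Lean document; each statement's English description precedes it below -/
import Mathlib

section
/- Let (A, B) be a co-t-structure on a triangulated category T and ω := A ∩ B. Then the following are equivalent: (1) (A, B) is faithful below, i.e., ∪_{n∈ℤ} A[n] = Δ̄_T(ω); (2) A^∧ = Δ̄_T(ω); (3) A^∧ ⊆ B^∨; (4) (A, B) is bounded above, i.e., ∪_{n∈ℤ} B[n] = T. -/
open CategoryTheory CategoryTheory.Limits CategoryTheory.Pretriangulated

universe v u

variable (C : Type u) [Category.{v} C] [HasZeroObject C] [HasShift C ℤ]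
  [Preadditive C] [∀ n : ℤ, (CategoryTheory.shiftFunctor C n).Additive]
  [Pretriangulated C]

namespace CotPaper

variable {C}

/-- The shift `X⟦n⟧` of a class of objects `X` by `n ∈ ℤ`, closed under isomorphism. -/
def shf (X : Set C) (n : ℤ) : Set C := {Z | ∃ A ∈ X, Nonempty (Z ≅ A⟦n⟧)}

/-- `star X Y` consists of the objects `Z` fitting in a distinguished triangle
`A ⟶ Z ⟶ B ⟶ A⟦1⟧` with `A ∈ X` and `B ∈ Y`. -/
def star (X Y : Set C) : Set C :=
  {Z | ∃ (A B : C) (f : A ⟶ Z) (g : Z ⟶ B) (h : B ⟶ A⟦(1:ℤ)⟧),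
    A ∈ X ∧ B ∈ Y ∧ Triangle.mk f g h ∈ distTriang C}

/-- `X^⊥ = {Z : Hom(X', Z) = 0 for all X' ∈ X}`. -/
def rightOrth (X : Set C) : Set C := {Z | ∀ A ∈ X, ∀ f : A ⟶ Z, f = 0}

/-- `⊥X = {Z : Hom(Z, X') = 0 for all X' ∈ X}`. -/
def leftOrth (X : Set C) : Set C := {Z | ∀ B ∈ X, ∀ f : Z ⟶ B, f = 0}

/-- A class of objects is closed under isomorphisms. -/
def isoClosed (X : Set C) : Prop := ∀ ⦃A B : C⦄, A ∈ X → (A ≅ B) → B ∈ X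

/-- A class of objects is closed under direct summands. -/
def summandClosed (X : Set C) : Prop :=
  ∀ ⦃W Z : C⦄, W ∈ X → (∃ (i : Z ⟶ W) (r : W ⟶ Z), i ≫ r = 𝟙 Z) → Z ∈ X

/-- `W` is a direct sum of `A` and `B` (i.e. carries a binary biproduct structure). -/
def isDirectSum (W A B : C) : Prop :=
  ∃ (iA : A ⟶ W) (iB : B ⟶ W) (pA : W ⟶ A) (pB : W ⟶ B),
    iA ≫ pA = 𝟙 A ∧ iB ≫ pB = 𝟙 B ∧ iA ≫ pB = 0 ∧ iB ≫ pA = 0 ∧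
      pA ≫ iA + pB ≫ iB = 𝟙 W

/-- An additive class of objects: it contains a zero object and is closed under
finite (binary) direct sums. -/
def addClosed (X : Set C) : Prop :=
  (∃ Z ∈ X, IsZero Z) ∧ ∀ ⦃A B W : C⦄, A ∈ X → B ∈ X → isDirectSum W A B → W ∈ X

/-- `X = add X` : `X` is closed under isomorphisms, finite direct sums and direct summands. -/
def isAdd (X : Set C) : Prop := isoClosed X ∧ addClosed X ∧ summandClosed X

/-- A class is suspended if it is closed under `[1]` and under extensions. -/
def suspended (X : Set C) : Prop := shf X 1 ⊆ X ∧ star X X ⊆ X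

/-- A class is cosuspended if it is closed under `[-1]` and under extensions. -/
def cosuspended (X : Set C) : Prop := shf X (-1) ⊆ X ∧ star X X ⊆ X

/-- `ε^∧_n(X)`: defined inductively, `ε^∧_0(X) = X` and `Z ∈ ε^∧_{n+1}(X)` iff there is a
distinguished triangle `Z⟦-1⟧ ⟶ W ⟶ A ⟶ Z` (equivalently `W ⟶ A ⟶ Z ⟶ W⟦1⟧`) with
`W ∈ ε^∧_n(X)` and `A ∈ X`. -/
def epsHat (X : Set C) : ℕ → Set C
  | 0 => X
  | n + 1 =>
    {Z | ∃ (W A : C) (f : W ⟶ A) (g : A ⟶ Z) (h : Z ⟶ W⟦(1:ℤ)⟧),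
      W ∈ epsHat X n ∧ A ∈ X ∧ Triangle.mk f g h ∈ distTriang C}

/-- `ε^∨_n(X)`: `ε^∨_0(X) = X` and `Z ∈ ε^∨_{n+1}(X)` iff there is a distinguished
triangle `Z ⟶ A ⟶ K ⟶ Z⟦1⟧` with `A ∈ X` and `K ∈ ε^∨_n(X)`. -/
def epsCheck (X : Set C) : ℕ → Set C
  | 0 => X
  | n + 1 =>
    {Z | ∃ (A K : C) (f : Z ⟶ A) (g : A ⟶ K) (h : K ⟶ Z⟦(1:ℤ)⟧),
      A ∈ X ∧ K ∈ epsCheck X n ∧ Triangle.mk f g h ∈ distTriang C}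

/-- `X^∧ := ∪_{n ≥ 0} ε^∧_n(X)`. -/
def hat (X : Set C) : Set C := ⋃ n : ℕ, epsHat X n

/-- `X^∨ := ∪_{n ≥ 0} ε^∨_n(X)`. -/
def check (X : Set C) : Set C := ⋃ n : ℕ, epsCheck X n

/-- `X~ := (X^∧)^∨`. -/
def tilde (X : Set C) : Set C := check (hat X)

/-- `resdim_X(M) := min {n : M ∈ ε^∧_n(X)}`, with `min ∅ = ∞`. -/
noncomputable def resdim (X : Set C) (M : C) : ℕ∞ :=
  sInf {n : ℕ∞ | ∃ m : ℕ, n = (m : ℕ∞) ∧ M ∈ epsHat X m}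

/-- `coresdim_X(M) := min {n : M ∈ ε^∨_n(X)}`, with `min ∅ = ∞`. -/
noncomputable def coresdim (X : Set C) (M : C) : ℕ∞ :=
  sInf {n : ℕ∞ | ∃ m : ℕ, n = (m : ℕ∞) ∧ M ∈ epsCheck X m}

/-- `id_X(M) := min {n ∈ ℕ : Hom(-, M[i])|_X = 0 for all i > n}`, with `min ∅ = ∞`. -/
noncomputable def idDim (X : Set C) (M : C) : ℕ∞ :=
  sInf {n : ℕ∞ | ∃ m : ℕ, n = (m : ℕ∞) ∧
    ∀ i : ℤ, (m : ℤ) < i → ∀ A ∈ X, ∀ f : A ⟶ M⟦i⟧, f = 0}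

/-- `pd_X(M) := min {n ∈ ℕ : Hom(M[-i], -)|_X = 0 for all i > n}`, with `min ∅ = ∞`. -/
noncomputable def pdDim (X : Set C) (M : C) : ℕ∞ :=
  sInf {n : ℕ∞ | ∃ m : ℕ, n = (m : ℕ∞) ∧
    ∀ i : ℤ, (m : ℤ) < i → ∀ B ∈ X, ∀ f : M⟦(-i : ℤ)⟧ ⟶ B, f = 0}

/-- `id_X(Y) := sup {id_X(M) : M ∈ Y}`. -/
noncomputable def idDimSet (X Y : Set C) : ℕ∞ := ⨆ M ∈ Y, idDim X M

/-- `pd_X(Y) := sup {pd_X(M) : M ∈ Y}`. -/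
noncomputable def pdDimSet (X Y : Set C) : ℕ∞ := ⨆ M ∈ Y, pdDim X M

/-- `ω` is `X`-injective: `id_X(W) = 0` for every `W ∈ ω`. -/
def xInjective (X ω : Set C) : Prop := ∀ W ∈ ω, idDim X W = 0

/-- `ω` is `X`-projective: `pd_X(W) = 0` for every `W ∈ ω`. -/
def xProjective (X ω : Set C) : Prop := ∀ W ∈ ω, pdDim X W = 0

/-- `ω` is a weak-cogenerator in `X`: `ω ⊆ X ⊆ X[-1] * ω`. -/
def weakCogenerator (ω X : Set C) : Prop := ω ⊆ X ∧ X ⊆ star (shf X (-1)) ω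

/-- `ω` is a weak-generator in `X`: `ω ⊆ X ⊆ ω * X[1]`. -/
def weakGenerator (ω X : Set C) : Prop := ω ⊆ X ∧ X ⊆ star ω (shf X 1)

/-- `ω` is silting: `Hom(W, W'[i]) = 0` for all `W, W' ∈ ω` and all `i > 0`. -/
def silting (ω : Set C) : Prop :=
  ∀ W ∈ ω, ∀ W' ∈ ω, ∀ i : ℤ, 0 < i → ∀ f : W ⟶ W'⟦i⟧, f = 0

/-- A thick subcategory: a (full, additive, isomorphism-closed) triangulated subcategory
closed under direct summands. -/
structure IsThick (S : Set C) : Prop where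
  zero : ∃ Z ∈ S, IsZero Z
  iso : isoClosed S
  shift : ∀ n : ℤ, shf S n ⊆ S
  ext : star S S ⊆ S
  summand : summandClosed S

/-- `Δ̄_T(X)`: the smallest thick subcategory containing `X`. -/
def thickClosure (X : Set C) : Set C := ⋂₀ {S : Set C | IsThick S ∧ X ⊆ S}

/-- `U_ω`: the smallest suspended class containing `ω`. -/
def uPlus (ω : Set C) : Set C := ⋂₀ {S : Set C | suspended S ∧ ω ⊆ S}

/-- `_ωU`: the smallest cosuspended class containing `ω`. -/
def uMinus (ω : Set C) : Set C := ⋂₀ {S : Set C | cosuspended S ∧ ω ⊆ S}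

/-- `_ωŪ`: the smallest cosuspended class containing `ω` closed under direct summands. -/
def uMinusBar (ω : Set C) : Set C :=
  ⋂₀ {S : Set C | cosuspended S ∧ summandClosed S ∧ ω ⊆ S}

/-- `(A, B)` is a co-t-structure on the triangulated subcategory `S` of `C`:
`A` and `B` are full additive subcategories of `S` closed under isomorphisms and direct
summands, `A[-1] ⊆ A`, `B[1] ⊆ B`, `Hom(A[-1], B) = 0` and `S = A[-1] * B`. -/
structure IsCotStructure (S A B : Set C) : Prop where
  subA : A ⊆ S
  subB : B ⊆ S
  isoA : isoClosed A
  isoB : isoClosed B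
  addA : addClosed A
  addB : addClosed B
  summandA : summandClosed A
  summandB : summandClosed B
  shiftA : shf A (-1) ⊆ A
  shiftB : shf B 1 ⊆ B
  orth : ∀ A' ∈ shf A (-1), ∀ B' ∈ B, ∀ f : A' ⟶ B', f = 0
  decomp : S = star (shf A (-1)) B

/-- A relative Auslander-Buchweitz context on `C` : `X` is cosuspended and closed under
direct summands, `Y` is suspended, closed under direct summands and `Y ⊆ X^∧`, and
`ω := X ∩ Y` is an `X`-injective weak-cogenerator in `X`. -/
structure RelativeABContext (X Y : Set C) : Prop where
  cosusp : cosuspended X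
  summandX : summandClosed X
  susp : suspended Y
  summandY : summandClosed Y
  sub : Y ⊆ hat X
  inj : xInjective X (X ∩ Y)
  wcog : weakCogenerator (X ∩ Y) X


section helpers

set_option linter.unusedSectionVars false
set_option linter.unusedVariables false
open scoped ZeroObject

theorem shf_mono {X Y : Set C} (h : X ⊆ Y) (n : ℤ) : shf X n ⊆ shf Y n := by
  rintro Z ⟨A, hA, e⟩
  exact ⟨A, h hA, e⟩

theorem mem_shf_shift {X : Set C} {Z : C} (hZ : Z ∈ X) (n : ℤ) : Z⟦n⟧ ∈ shf X n :=
  ⟨Z, hZ, ⟨Iso.refl _⟩⟩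

theorem shf_iso (X : Set C) (n : ℤ) : isoClosed (shf X n) := by
  rintro Z W ⟨A, hA, ⟨e⟩⟩ e'
  exact ⟨A, hA, ⟨e'.symm ≪≫ e⟩⟩

theorem shf_shf (X : Set C) (n m k : ℤ) (hk : n + m = k) : shf (shf X n) m = shf X k := by
  ext Z
  constructor
  · rintro ⟨W, ⟨A, hA, ⟨e⟩⟩, ⟨e'⟩⟩
    exact ⟨A, hA, ⟨e' ≪≫ (shiftFunctor C m).mapIso e ≪≫ ((shiftFunctorAdd' C n m k hk).app A).symm⟩⟩
  · rintro ⟨A, hA, ⟨e⟩⟩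
    exact ⟨A⟦n⟧, mem_shf_shift hA n, ⟨e ≪≫ (shiftFunctorAdd' C n m k hk).app A⟩⟩

theorem shf_zero {X : Set C} (hX : isoClosed X) : shf X 0 = X := by
  ext Z
  constructor
  · rintro ⟨A, hA, ⟨e⟩⟩
    exact hX hA (e ≪≫ (shiftFunctorZero C ℤ).app A).symm
  · intro hZ
    exact ⟨Z, hZ, ⟨((shiftFunctorZero C ℤ).app Z).symm⟩⟩

theorem shf_cancel {X : Set C} (hX : isoClosed X) {Z : C} {n : ℤ} (h : Z⟦n⟧ ∈ shf X n) :
    Z ∈ X := by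
  have h1 := mem_shf_shift h (-n)
  rw [shf_shf X n (-n) 0 (by omega), shf_zero hX] at h1
  exact hX h1 ((shiftFunctorCompIsoId C n (-n) (by omega)).app Z)

structure Good (X : Set C) : Prop where
  iso : isoClosed X
  ext : star X X ⊆ X
  summand : summandClosed X

theorem ext_tri {X : Set C} (h : star X X ⊆ X) (T : Triangle C) (hT : T ∈ distTriang C)
    (h1 : T.obj₁ ∈ X) (h3 : T.obj₃ ∈ X) : T.obj₂ ∈ X :=
  h ⟨T.obj₁, T.obj₃, T.mor₁, T.mor₂, T.mor₃, h1, h3, hT⟩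

theorem Good.shf {X : Set C} (h : Good X) (n : ℤ) : Good (shf X n) where
  iso := shf_iso X n
  ext := by
    rintro Z ⟨P, Q, f, g, k, hP, hQ, hT⟩
    have hP' := mem_shf_shift hP (-n)
    have hQ' := mem_shf_shift hQ (-n)
    rw [shf_shf X n (-n) 0 (by omega), shf_zero h.iso] at hP' hQ'
    have := ext_tri h.ext _ (Triangle.shift_distinguished _ hT (-n)) hP' hQ'
    exact shf_iso X n (mem_shf_shift this n) ((shiftFunctorCompIsoId C (-n) n (by omega)).app Z)
  summand := by
    rintro W Z hW ⟨i, r, hir⟩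
    have hW' := mem_shf_shift hW (-n)
    rw [shf_shf X n (-n) 0 (by omega), shf_zero h.iso] at hW'
    have : Z⟦-n⟧ ∈ X := h.summand hW' ⟨i⟦-n⟧', r⟦-n⟧', by
      rw [← Functor.map_comp, hir, CategoryTheory.Functor.map_id]⟩
    exact shf_iso X n (mem_shf_shift this n) ((shiftFunctorCompIsoId C (-n) n (by omega)).app Z)

theorem good_leftOrth (X : Set C) : Good (leftOrth X) where
  iso := by
    intro P Q hP e B hB f
    rw [← cancel_epi e.hom, comp_zero]
    exact hP B hB _
  ext := by
    rintro Z ⟨P, Q, f, g, k, hP, hQ, hT⟩ B hB u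
    obtain ⟨v, hv⟩ : ∃ v : Q ⟶ B, u = g ≫ v := Triangle.yoneda_exact₂ _ hT u (hP B hB _)
    have hv0 : v = 0 := hQ B hB v
    rw [hv, hv0, comp_zero]
  summand := by
    rintro W Z hW ⟨i, r, hir⟩ B hB f
    rw [← Category.id_comp f, ← hir, Category.assoc, hW B hB (r ≫ f), comp_zero]

theorem good_rightOrth (X : Set C) : Good (rightOrth X) where
  iso := by
    intro P Q hP e B hB f
    rw [← cancel_mono e.inv, zero_comp]
    exact hP B hB _
  ext := by
    rintro Z ⟨P, Q, f, g, k, hP, hQ, hT⟩ B hB u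
    obtain ⟨v, hv⟩ : ∃ v : B ⟶ P, u = v ≫ f := Triangle.coyoneda_exact₂ _ hT u (hQ B hB _)
    have hv0 : v = 0 := hP B hB v
    rw [hv, hv0, zero_comp]
  summand := by
    rintro W Z hW ⟨i, r, hir⟩ B hB f
    rw [← Category.comp_id f, ← hir, ← Category.assoc, hW B hB (f ≫ i), zero_comp]

theorem mono_up {A : Set C} (hi : isoClosed A) (hA : shf A (-1) ⊆ A) (n : ℤ) (k : ℕ) :
    shf A n ⊆ shf A (n + k) := by
  induction k with
  | zero => simp
  | succ k ih =>
    refine ih.trans ?_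
    have := shf_mono hA (n + k + 1)
    rwa [shf_shf A (-1) (n + k + 1) (n + k) (by omega), add_assoc] at this

theorem mono_down {B : Set C} (hi : isoClosed B) (hB : shf B 1 ⊆ B) (n : ℤ) (k : ℕ) :
    shf B n ⊆ shf B (n - k) := by
  induction k with
  | zero => simp
  | succ k ih =>
    refine ih.trans ?_
    have := shf_mono hB (n - k - 1)
    rwa [shf_shf B 1 (n - k - 1) (n - k) (by omega), sub_sub] at this

theorem thick_union {X : Set C} (h : Good X) (h0 : ∃ Z ∈ X, IsZero Z)
    (hd : ∀ m n : ℤ, ∃ k, shf X m ⊆ shf X k ∧ shf X n ⊆ shf X k) :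
    IsThick (⋃ n : ℤ, shf X n) where
  zero := by
    obtain ⟨Z, hZ, h0⟩ := h0
    exact ⟨Z, Set.mem_iUnion.2 ⟨0, by rwa [shf_zero h.iso]⟩, h0⟩
  iso := by
    intro P Q hP e
    obtain ⟨n, hn⟩ := Set.mem_iUnion.1 hP
    exact Set.mem_iUnion.2 ⟨n, shf_iso X n hn e⟩
  shift := by
    rintro n Z ⟨P, hP, e⟩
    obtain ⟨m, hm⟩ := Set.mem_iUnion.1 hP
    refine Set.mem_iUnion.2 ⟨m + n, ?_⟩
    rw [← shf_shf X m n _ rfl]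
    exact ⟨P, hm, e⟩
  ext := by
    rintro Z ⟨P, Q, f, g, k, hP, hQ, hT⟩
    obtain ⟨m, hm⟩ := Set.mem_iUnion.1 hP
    obtain ⟨n, hn⟩ := Set.mem_iUnion.1 hQ
    obtain ⟨l, h1, h2⟩ := hd m n
    exact Set.mem_iUnion.2 ⟨l, ext_tri (h.shf l).ext _ hT (h1 hm) (h2 hn)⟩
  summand := by
    intro W Z hW hZ
    obtain ⟨n, hn⟩ := Set.mem_iUnion.1 hW
    exact Set.mem_iUnion.2 ⟨n, (h.shf n).summand hn hZ⟩

theorem thick_closure (X : Set C) : IsThick (thickClosure X) where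
  zero := by
    refine ⟨0, ?_, isZero_zero C⟩
    rintro S ⟨hS, -⟩
    obtain ⟨Z, hZ, h0⟩ := hS.zero
    exact hS.iso hZ (h0.iso (isZero_zero C))
  iso := fun P Q hP e S hS => hS.1.iso (hP S hS) e
  shift := by
    rintro n Z ⟨P, hP, e⟩ S hS
    exact hS.1.shift n ⟨P, hP S hS, e⟩
  ext := by
    rintro Z ⟨P, Q, f, g, k, hP, hQ, hT⟩ S hS
    exact hS.1.ext ⟨P, Q, f, g, k, hP S hS, hQ S hS, hT⟩
  summand := fun W Z hW hZ S hS => hS.1.summand (hW S hS) hZ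

theorem mem_of_iso_zero {X : Set C} (hi : isoClosed X) (h0 : ∃ Z ∈ X, IsZero Z) {Z : C}
    (hZ : IsZero Z) : Z ∈ X := by
  obtain ⟨W, hW, h⟩ := h0
  exact hi hW (h.iso hZ)

section cot
variable {A B : Set C}

theorem cot_dec (h : IsCotStructure Set.univ A B) (Z : C) : Z ∈ star (shf A (-1)) B := by
  rw [← h.decomp]; trivial

theorem cot_left (h : IsCotStructure Set.univ A B) : shf A (-1) = leftOrth B := by
  apply Set.Subset.antisymm h.orth
  intro Z hZ
  obtain ⟨P, Q, f, g, k, ⟨A0, hA0, ⟨e⟩⟩, hQ, hT⟩ := cot_dec h Z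
  obtain ⟨s, hs⟩ : ∃ s : Z ⟶ P, 𝟙 Z = s ≫ f := Triangle.coyoneda_exact₂ _ hT (𝟙 Z) (hZ Q hQ (𝟙 Z ≫ g))
  have hs' : 𝟙 Z = s ≫ f := hs
  have : Z⟦(1:ℤ)⟧ ∈ A := h.summandA hA0
    ⟨s⟦(1:ℤ)⟧' ≫ e.hom⟦(1:ℤ)⟧' ≫ (shiftFunctorCompIsoId C (-1:ℤ) 1 (by omega)).hom.app A0,
     (shiftFunctorCompIsoId C (-1:ℤ) 1 (by omega)).inv.app A0 ≫ e.inv⟦(1:ℤ)⟧' ≫ f⟦(1:ℤ)⟧', by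
      simp only [Category.assoc, Iso.hom_inv_id_app_assoc]
      rw [← CategoryTheory.Functor.map_comp_assoc (shiftFunctor C (1:ℤ)) e.hom, e.hom_inv_id,
        CategoryTheory.Functor.map_id, Category.id_comp]
      exact ((shiftFunctor C (1:ℤ)).map_comp s f).symm.trans
        ((congrArg (shiftFunctor C (1:ℤ)).map hs'.symm).trans
          (CategoryTheory.Functor.map_id _ _))⟩
  exact ⟨_, this, ⟨((shiftFunctorCompIsoId C (1:ℤ) (-1) (by omega)).app Z).symm⟩⟩

theorem cot_right (h : IsCotStructure Set.univ A B) : B = rightOrth (shf A (-1)) := by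
  apply Set.Subset.antisymm (fun b hb a ha f => h.orth a ha b hb f)
  intro Z hZ
  obtain ⟨P, Q, f, g, k, hP, hQ, hT⟩ := cot_dec h Z
  obtain ⟨s, hs⟩ := Triangle.yoneda_exact₂ _ hT (𝟙 Z) (hZ P hP (f ≫ 𝟙 Z))
  exact h.summandB hQ ⟨g, s, hs.symm⟩

theorem cot_goodB (h : IsCotStructure Set.univ A B) : Good B := by
  rw [cot_right h]; exact good_rightOrth _

theorem cot_goodA (h : IsCotStructure Set.univ A B) : Good A := by
  have := (good_leftOrth B).shf 1
  rwa [← cot_left h, shf_shf A (-1) 1 0 (by omega), shf_zero h.isoA] at this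

theorem cot_thickA (h : IsCotStructure Set.univ A B) : IsThick (⋃ n : ℤ, shf A n) := by
  refine thick_union (cot_goodA h) h.addA.1 fun m n => ⟨max m n, ?_, ?_⟩
  · have := mono_up h.isoA h.shiftA m (max m n - m).toNat
    rwa [show m + ((max m n - m).toNat : ℤ) = max m n by omega] at this
  · have := mono_up h.isoA h.shiftA n (max m n - n).toNat
    rwa [show n + ((max m n - n).toNat : ℤ) = max m n by omega] at this

theorem cot_downB (h : IsCotStructure Set.univ A B) {m n : ℤ} (hmn : n ≤ m) :
    shf B m ⊆ shf B n := by
  have := mono_down h.isoB h.shiftB m (m - n).toNat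
  rwa [show m - ((m - n).toNat : ℤ) = n by omega] at this

theorem cot_thickB (h : IsCotStructure Set.univ A B) : IsThick (⋃ n : ℤ, shf B n) :=
  thick_union (cot_goodB h) h.addB.1 fun m n =>
    ⟨min m n, cot_downB h (by omega), cot_downB h (by omega)⟩

theorem cot_hat (h : IsCotStructure Set.univ A B) : hat A = ⋃ n : ℤ, shf A n := by
  have h1 : ∀ n : ℕ, epsHat A n = shf A n := by
    intro n
    induction n with
    | zero => simp [epsHat, shf_zero h.isoA]
    | succ n ih =>
      ext Z
      constructor
      · rintro ⟨W, P, f, g, k, hW, hP, hT⟩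
        rw [ih] at hW
        refine ext_tri ((cot_goodA h).shf _).ext _ (rot_of_distTriang _ hT) ?_ ?_
        · have := mono_up h.isoA h.shiftA 0 (n + 1)
          rw [shf_zero h.isoA, zero_add] at this
          exact this hP
        · have := mem_shf_shift hW 1
          rwa [shf_shf A n 1 ((n + 1 : ℕ) : ℤ) (by push_cast; rfl)] at this
      · intro hZ
        have hZ' := mem_shf_shift hZ (-1)
        rw [shf_shf A _ (-1) n (by push_cast; omega), ← ih] at hZ'
        have hT := inv_rot_of_distTriang _ (contractible_distinguished₁ Z)
        exact ⟨Z⟦(-1:ℤ)⟧, 0, _, _, _, hZ',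
          mem_of_iso_zero h.isoA h.addA.1 (isZero_zero C), hT⟩
  apply Set.Subset.antisymm
  · refine Set.iUnion_subset fun n => ?_
    rw [h1 n]
    exact Set.subset_iUnion (fun n : ℤ => shf A n) (n : ℤ)
  · refine Set.iUnion_subset fun n => ?_
    have := mono_up h.isoA h.shiftA n (n.toNat - n).toNat
    rw [show n + ((n.toNat - n).toNat : ℤ) = n.toNat by omega, ← h1] at this
    exact this.trans (Set.subset_iUnion (fun n : ℕ => epsHat A n) _)

theorem cot_check (h : IsCotStructure Set.univ A B) : check B = ⋃ n : ℤ, shf B n := by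
  have h1 : ∀ n : ℕ, epsCheck B n = shf B (-n) := by
    intro n
    induction n with
    | zero => simp [epsCheck, shf_zero h.isoB]
    | succ n ih =>
      ext Z
      constructor
      · rintro ⟨P, K, f, g, k, hP, hK, hT⟩
        rw [ih] at hK
        refine ext_tri ((cot_goodB h).shf _).ext _ (inv_rot_of_distTriang _ hT) ?_ ?_
        · have := mem_shf_shift hK (-1)
          rwa [shf_shf B (-n) (-1) (-((n + 1 : ℕ) : ℤ)) (by push_cast; omega)] at this
        · rw [← shf_zero h.isoB] at hP
          exact cot_downB h (by omega) hP
      · intro hZ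
        have hZ' := mem_shf_shift hZ 1
        rw [shf_shf B _ 1 (-n) (by push_cast; omega), ← ih] at hZ'
        exact ⟨0, Z⟦(1:ℤ)⟧, _, _, _, 
          mem_of_iso_zero h.isoB h.addB.1 (isZero_zero C), hZ', contractible_distinguished₂ Z⟩
  apply Set.Subset.antisymm
  · refine Set.iUnion_subset fun n => ?_
    rw [h1 n]
    exact Set.subset_iUnion (fun n : ℤ => shf B n) (-n : ℤ)
  · refine Set.iUnion_subset fun n => ?_
    have := cot_downB h (m := n) (n := -((-n).toNat : ℤ)) (by omega)
    rw [← h1] at this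
    exact this.trans (Set.subset_iUnion (fun n : ℕ => epsCheck B n) _)

theorem cot_key (h : IsCotStructure Set.univ A B) (n : ℕ) :
    ∀ X ∈ A, X ∈ shf B (-n) → X ∈ thickClosure (A ∩ B) := by
  induction n with
  | zero =>
    intro X hA hB S hS
    have hB' : X ∈ B := by simpa [shf_zero h.isoB] using hB
    exact hS.2 ⟨hA, hB'⟩
  | succ n ih =>
    intro X hA hB
    obtain ⟨P, Q, f, g, k, hP, hQ, hT⟩ := cot_dec h X
    have hP1 : P⟦(1:ℤ)⟧ ∈ A := by
      have := mem_shf_shift hP 1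
      rwa [shf_shf A (-1) 1 0 (by omega), shf_zero h.isoA] at this
    have hQA : Q ∈ A := ext_tri (cot_goodA h).ext _ (rot_of_distTriang _ hT) hA hP1
    have hQt : Q ∈ thickClosure (A ∩ B) := fun S hS => hS.2 ⟨hQA, hQ⟩
    have hPB : P ∈ shf B (-((n + 1 : ℕ) : ℤ)) :=
      ext_tri ((cot_goodB h).shf _).ext _ (inv_rot_of_distTriang _ hT)
        (cot_downB h (m := -1) (by omega) (mem_shf_shift hQ (-1))) hB
    have hPB1 := mem_shf_shift hPB 1
    rw [shf_shf B _ 1 (-n) (by push_cast; omega)] at hPB1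
    have hPt := ih _ hP1 hPB1
    have ht := thick_closure (A ∩ B)
    have hPt' : P ∈ thickClosure (A ∩ B) :=
      ht.iso (ht.shift (-1) (mem_shf_shift hPt (-1)))
        ((shiftFunctorCompIsoId C (1:ℤ) (-1) (by omega)).app P)
    exact ext_tri ht.ext _ hT hPt' hQt

end cot

end helpers

/-- For a co-t-structure `(A, B)` on `T` with `ω := A ∩ B`, the following
are equivalent: (1) `(A, B)` is faithful below, i.e. `∪_{n∈ℤ} A[n] = Δ̄_T(ω)`;
(2) `A^∧ = Δ̄_T(ω)`; (3) `A^∧ ⊆ B^∨`; (4) `(A, B)` is bounded above, i.e.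
`∪_{n∈ℤ} B[n] = T`. -/
theorem stmt8 (A B : Set C) (h : IsCotStructure Set.univ A B) :
    [(⋃ n : ℤ, shf A n) = thickClosure (A ∩ B),
     hat A = thickClosure (A ∩ B),
     hat A ⊆ check B,
     (⋃ n : ℤ, shf B n) = Set.univ].TFAE := by
  rw [cot_hat h, cot_check h]
  have hsub : ∀ {X : Set C}, A ∩ B ⊆ X → isoClosed X → IsThick (⋃ n : ℤ, shf X n) →
      thickClosure (A ∩ B) ⊆ ⋃ n : ℤ, shf X n := by
    intro X hX hi hT
    refine Set.sInter_subset_of_mem ⟨hT, hX.trans ?_⟩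
    have := Set.subset_iUnion (fun n : ℤ => shf X n) 0
    rwa [shf_zero hi] at this
  tfae_have 1 ↔ 2 := Iff.rfl
  tfae_have 2 → 3 := by
    intro h2
    rw [h2]
    exact hsub Set.inter_subset_right h.isoB (cot_thickB h)
  tfae_have 3 → 2 := by
    intro h3
    refine Set.Subset.antisymm ?_ (hsub Set.inter_subset_left h.isoA (cot_thickA h))
    refine Set.iUnion_subset fun n => ?_
    refine subset_trans (shf_mono ?_ n) ((thick_closure (A ∩ B)).shift n)
    intro X hX
    have hX' : X ∈ ⋃ n : ℤ, shf A n :=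
      Set.mem_iUnion.2 ⟨0, by rwa [shf_zero h.isoA]⟩
    obtain ⟨m, hm⟩ := Set.mem_iUnion.1 (h3 hX')
    exact cot_key h (-m).toNat X hX (cot_downB h (by omega) hm)
  tfae_have 4 → 3 := by
    intro h4
    rw [h4]
    exact Set.subset_univ _
  tfae_have 3 → 4 := by
    intro h3
    refine Set.eq_univ_of_forall fun Z => ?_
    obtain ⟨P, Q, f, g, k, hP, hQ, hT⟩ := cot_dec h Z
    exact ext_tri (cot_thickB h).ext _ hT (h3 (Set.mem_iUnion.2 ⟨-1, hP⟩))
      (Set.mem_iUnion.2 ⟨0, by rwa [Triangle.mk_obj₃, shf_zero h.isoB]⟩)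
  tfae_finish

end CotPaper
end

section
/- Let (A, B) be a bounded co-t-structure on a triangulated category T and ω := A ∩ B. Then: (a) Δ̄_T(ω) = (ω^∧)^∨ = (ω^∨)^∧ = T, U_ω = ω^∧ = B, and _ωU = ω^∨ = A; (b) id_A(C) = id_ω(C) = coresdim_B(C) < ∞ for all C ∈ T; (c) pd_B(C) = pd_ω(C) = resdim_A(C) < ∞ for all C ∈ T; (d) coresdim_B(C) = coresdim_ω(C) < ∞ for all C ∈ A; (e) resdim_A(C) = resdim_ω(C) < ∞ for all C ∈ B. -/
open CategoryTheory CategoryTheory.Limits CategoryTheory.Pretriangulated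

universe v u

variable (C : Type u) [Category.{v} C] [HasZeroObject C] [HasShift C ℤ]
  [Preadditive C] [∀ n : ℤ, (CategoryTheory.shiftFunctor C n).Additive]
  [Pretriangulated C]

namespace CotPaper

variable {C}

section helpers

/-- `M⟦n⟧` is in `X`. -/
def inSh (X : Set C) (n : ℤ) (M : C) : Prop := M⟦n⟧ ∈ X

lemma inSh_zero {X : Set C} (hi : isoClosed X) (M : C) : inSh X 0 M ↔ M ∈ X :=
  ⟨fun h => hi h ((shiftFunctorZero C ℤ).app M), fun h => hi h ((shiftFunctorZero C ℤ).app M).symm⟩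

lemma inSh_iso {X : Set C} (hi : isoClosed X) {n : ℤ} {M N : C} (e : M ≅ N) (h : inSh X n M) :
    inSh X n N := hi h ((shiftFunctor C n).mapIso e)

lemma inSh_shift {X : Set C} (hi : isoClosed X) (M : C) (a b c : ℤ) (h : a + b = c) :
    inSh X b (M⟦a⟧) ↔ inSh X c M :=
  ⟨fun h' => hi h' ((shiftFunctorAdd' C a b c h).app M).symm,
   fun h' => hi h' ((shiftFunctorAdd' C a b c h).app M)⟩

lemma mem_shf {X : Set C} (hi : isoClosed X) (M : C) (n m : ℤ) (hm : n + m = 0) :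
    M ∈ shf X n ↔ inSh X m M := by
  constructor
  · rintro ⟨Y, hY, ⟨e⟩⟩
    refine inSh_iso hi e.symm ?_
    rw [inSh_shift hi Y n m 0 hm, inSh_zero hi]
    exact hY
  · intro h
    refine ⟨M⟦m⟧, h, ⟨?_⟩⟩
    exact (shiftFunctorZero C ℤ).symm.app M ≪≫ (shiftFunctorAdd' C m n 0 (by omega)).app M

lemma ext2 {X : Set C} (hX : star X X ⊆ X) (n : ℤ) (T : Triangle C) (hT : T ∈ distTriang C)
    (h1 : inSh X n T.obj₁) (h3 : inSh X n T.obj₃) : inSh X n T.obj₂ :=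
  hX ⟨_, _, _, _, _, h1, h3, Triangle.shift_distinguished T hT n⟩

lemma ext3 {X : Set C} (hi : isoClosed X) (hX : star X X ⊆ X) (n k : ℤ) (hk : k = n + 1)
    (T : Triangle C) (hT : T ∈ distTriang C)
    (h1 : inSh X k T.obj₁) (h2 : inSh X n T.obj₂) : inSh X n T.obj₃ :=
  ext2 hX n T.rotate (rot_of_distTriang T hT) h2
    ((inSh_shift hi T.obj₁ 1 n k (by omega)).2 h1)

lemma ext1 {X : Set C} (hi : isoClosed X) (hX : star X X ⊆ X) (n k : ℤ) (hk : k = n - 1)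
    (T : Triangle C) (hT : T ∈ distTriang C)
    (h3 : inSh X k T.obj₃) (h2 : inSh X n T.obj₂) : inSh X n T.obj₁ :=
  ext2 hX n T.invRotate (inv_rot_of_distTriang T hT)
    ((inSh_shift hi T.obj₃ (-1) n k (by omega)).2 h3) h2

lemma shift_zero_iff (X Y : C) (n : ℤ) (a b : ℤ) (hb : a + n = b) :
    (∀ f : X ⟶ Y⟦b⟧, f = 0) ↔ (∀ f : X⟦-n⟧ ⟶ Y⟦a⟧, f = 0) := by
  have e1 : (X⟦-n⟧)⟦n⟧ ≅ X :=
    ((shiftFunctorAdd' C (-n) n 0 (by omega)).symm.app X) ≪≫ (shiftFunctorZero C ℤ).app X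
  have e2 : (Y⟦a⟧)⟦n⟧ ≅ Y⟦b⟧ := (shiftFunctorAdd' C a n b hb).symm.app Y
  constructor
  · intro h f
    apply (shiftFunctor C n).map_injective
    have := h (e1.inv ≫ (shiftFunctor C n).map f ≫ e2.hom)
    rw [Functor.map_zero, ← cancel_epi e1.inv, ← cancel_mono e2.hom]
    simpa using this
  · intro h f
    obtain ⟨g, hg⟩ := (shiftFunctor C n).map_surjective (e1.hom ≫ f ≫ e2.inv)
    rw [h g, Functor.map_zero] at hg
    rw [← cancel_epi e1.hom, ← cancel_mono e2.inv]
    simpa using hg.symm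

lemma epsCheck_mono {X Y : Set C} (h : X ⊆ Y) (n : ℕ) : epsCheck X n ⊆ epsCheck Y n := by
  induction n with
  | zero => exact h
  | succ n ih =>
    rintro Z ⟨P, K, f, g, w, hP, hK, hT⟩
    exact ⟨P, K, f, g, w, h hP, ih hK, hT⟩

lemma epsHat_mono {X Y : Set C} (h : X ⊆ Y) (n : ℕ) : epsHat X n ⊆ epsHat Y n := by
  induction n with
  | zero => exact h
  | succ n ih =>
    rintro Z ⟨P, K, f, g, w, hP, hK, hT⟩
    exact ⟨P, K, f, g, w, ih hP, h hK, hT⟩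

lemma epsHat_sub_susp {X S : Set C} (h : X ⊆ S) (hs : suspended S) (n : ℕ) : epsHat X n ⊆ S := by
  induction n with
  | zero => exact h
  | succ n ih =>
    rintro Z ⟨P, K, f, g, w, hP, hK, hT⟩
    exact hs.2 ⟨_, _, _, _, _, h hK, hs.1 ⟨P, ih hP, ⟨Iso.refl _⟩⟩, rot_of_distTriang _ hT⟩

lemma epsCheck_sub_cosusp {X S : Set C} (h : X ⊆ S) (hs : cosuspended S) (n : ℕ) :
    epsCheck X n ⊆ S := by
  induction n with
  | zero => exact h
  | succ n ih =>
    rintro Z ⟨P, K, f, g, w, hP, hK, hT⟩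
    exact hs.2 ⟨_, _, _, _, _, hs.1 ⟨K, ih hK, ⟨Iso.refl _⟩⟩, h hP, inv_rot_of_distTriang _ hT⟩

variable {A B : Set C}

lemma cot_dec_s9 (h : IsCotStructure Set.univ A B) (M : C) :
    ∃ T : Triangle C, T ∈ distTriang C ∧ T.obj₂ = M ∧ inSh A 1 T.obj₁ ∧ T.obj₃ ∈ B := by
  have : M ∈ star (shf A (-1)) B := by rw [← h.decomp]; trivial
  obtain ⟨a, b, f, g, w, ha, hb, hT⟩ := this
  exact ⟨_, hT, rfl, (mem_shf h.isoA a (-1) 1 (by omega)).1 ha, hb⟩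

lemma cot_orth (h : IsCotStructure Set.univ A B) {M N : C} (hM : inSh A 1 M) (hN : N ∈ B)
    (f : M ⟶ N) : f = 0 :=
  h.orth M ((mem_shf h.isoA M (-1) 1 (by omega)).2 hM) N hN f

lemma memB (h : IsCotStructure Set.univ A B) (M : C)
    (hM : ∀ a, inSh A 1 a → ∀ f : a ⟶ M, f = 0) : M ∈ B := by
  obtain ⟨T, hT, rfl, h1, h3⟩ := cot_dec_s9 h M
  obtain ⟨r, hr⟩ := Triangle.yoneda_exact₂ T hT (𝟙 _) (by simpa using hM _ h1 T.mor₁)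
  exact h.summandB h3 ⟨T.mor₂, r, hr.symm⟩

lemma memA (h : IsCotStructure Set.univ A B) (M : C)
    (hM : ∀ b ∈ B, ∀ f : M ⟶ b, f = 0) : inSh A 1 M := by
  obtain ⟨T, hT, rfl, h1, h3⟩ := cot_dec_s9 h M
  obtain ⟨r, hr⟩ := Triangle.coyoneda_exact₂ T hT (𝟙 _) (by simpa using hM _ h3 T.mor₂)
  refine h.summandA h1 ⟨(shiftFunctor C (1:ℤ)).map r, (shiftFunctor C (1:ℤ)).map T.mor₁, ?_⟩
  rw [← Functor.map_comp, ← hr, CategoryTheory.Functor.map_id]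

lemma extB (h : IsCotStructure Set.univ A B) : star B B ⊆ B := by
  rintro M ⟨P, Q, f, g, w, hP, hQ, hT⟩
  apply memB h
  intro a ha u
  obtain ⟨r, hr⟩ := Triangle.coyoneda_exact₂ _ hT u (cot_orth h ha hQ _)
  rw [hr]
  exact (congrArg (· ≫ _) (cot_orth h ha hP r)).trans zero_comp

lemma extA (h : IsCotStructure Set.univ A B) : star A A ⊆ A := by
  rintro M ⟨P, Q, f, g, w, hP, hQ, hT⟩
  have key : inSh A 1 (M⟦(-1:ℤ)⟧) := by
    apply memA h
    intro b hb u
    have hT' := Triangle.shift_distinguished _ hT (-1)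
    have hP' : inSh A 1 (P⟦(-1:ℤ)⟧) :=
      (inSh_shift h.isoA P (-1) 1 0 (by omega)).2 ((inSh_zero h.isoA _).2 hP)
    have hQ' : inSh A 1 (Q⟦(-1:ℤ)⟧) :=
      (inSh_shift h.isoA Q (-1) 1 0 (by omega)).2 ((inSh_zero h.isoA _).2 hQ)
    obtain ⟨r, hr⟩ := Triangle.yoneda_exact₂ _ hT' u (cot_orth h hP' hb _)
    rw [hr]
    exact (congrArg _ (cot_orth h hQ' hb r)).trans comp_zero
  exact (inSh_zero h.isoA _).1 ((inSh_shift h.isoA M (-1) 1 0 (by omega)).1 key)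

lemma monoB (h : IsCotStructure Set.univ A B) (M : C) (n : ℤ) (k : ℕ) (hM : inSh B n M) :
    inSh B (n + k) M := by
  induction k with
  | zero => simpa using hM
  | succ k ih =>
    refine (inSh_shift h.isoB M (n+k) 1 _ (by push_cast; ring)).1 ?_
    exact h.shiftB ⟨_, ih, ⟨Iso.refl _⟩⟩

lemma monoA (h : IsCotStructure Set.univ A B) (M : C) (n : ℤ) (k : ℕ) (hM : inSh A n M) :
    inSh A (n - k) M := by
  induction k with
  | zero => simpa using hM
  | succ k ih =>
    refine (inSh_shift h.isoA M (n-k) (-1) _ (by push_cast; ring)).1 ?_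
    exact h.shiftA ⟨_, ih, ⟨Iso.refl _⟩⟩

lemma monoB' (h : IsCotStructure Set.univ A B) {M : C} {n m : ℤ} (hM : inSh B n M)
    (hnm : n ≤ m) : inSh B m M := by
  have := monoB h M n (m - n).toNat hM
  rwa [show n + ((m - n).toNat : ℤ) = m by omega] at this

lemma monoA' (h : IsCotStructure Set.univ A B) {M : C} {n m : ℤ} (hM : inSh A n M)
    (hnm : m ≤ n) : inSh A m M := by
  have := monoA h M n (n - m).toNat hM
  rwa [show n - ((n - m).toNat : ℤ) = m by omega] at this

lemma suspB (h : IsCotStructure Set.univ A B) : suspended B := ⟨h.shiftB, extB h⟩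
lemma cosuspA (h : IsCotStructure Set.univ A B) : cosuspended A := ⟨h.shiftA, extA h⟩

/-- Decomposition `M ⟶ b ⟶ a ⟶ M⟦1⟧`. -/
lemma decL (h : IsCotStructure Set.univ A B) (M : C) :
    ∃ (b a : C) (f : M ⟶ b) (g : b ⟶ a) (w : a ⟶ M⟦(1:ℤ)⟧), b ∈ B ∧ a ∈ A ∧
      Triangle.mk f g w ∈ distTriang C ∧ (M ∈ A → b ∈ A) := by
  obtain ⟨T, hT, rfl, h1, h3⟩ := cot_dec_s9 h M
  refine ⟨_, _, _, _, _, h3, h1, rot_of_distTriang T hT, fun hM => ?_⟩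
  exact extA h ⟨_, _, _, _, _, hM, h1, rot_of_distTriang T hT⟩

/-- Decomposition `b ⟶ a ⟶ N ⟶ b⟦1⟧`. -/
lemma decR (h : IsCotStructure Set.univ A B) (N : C) :
    ∃ (b a : C) (f : b ⟶ a) (g : a ⟶ N) (w : N ⟶ b⟦(1:ℤ)⟧), b ∈ B ∧ a ∈ A ∧
      Triangle.mk f g w ∈ distTriang C ∧ (N ∈ B → a ∈ B) := by
  obtain ⟨b, a, f, g, w, hb, ha, hT, -⟩ := decL h (N⟦(-1:ℤ)⟧)
  let e : (N⟦(-1:ℤ)⟧)⟦(1:ℤ)⟧ ≅ N :=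
    ((shiftFunctorAdd' C (-1) 1 0 (by omega)).symm.app N) ≪≫ (shiftFunctorZero C ℤ).app N
  have hT2 : Triangle.mk g (w ≫ e.hom) (e.inv ≫ (-f⟦(1:ℤ)⟧')) ∈ distTriang C := by
    refine isomorphic_distinguished _ (rot_of_distTriang _ hT) _ ?_
    exact Triangle.isoMk _ _ (Iso.refl _) (Iso.refl _) e.symm
      ((Category.comp_id g).trans (Category.id_comp g).symm)
      (((Category.assoc w e.hom e.inv).trans (by rw [e.hom_inv_id, Category.comp_id])).trans
        (Category.id_comp w).symm)
      ((congrArg (_ ≫ ·) (CategoryTheory.Functor.map_id (shiftFunctor C (1:ℤ)) b)).trans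
        (Category.comp_id _))
  refine ⟨_, _, _, _, _, hb, ha, hT2, fun hN => ?_⟩
  have h2 := ext2 (extB h) 0 _ hT2 ((inSh_zero h.isoB _).2 hb) ((inSh_zero h.isoB _).2 hN)
  exact (inSh_zero h.isoB _).1 h2

lemma epsCheckB_iff (h : IsCotStructure Set.univ A B) (n : ℕ) (M : C) :
    M ∈ epsCheck B n ↔ inSh B n M := by
  induction n generalizing M with
  | zero => exact (inSh_zero h.isoB M).symm
  | succ n ih =>
    constructor
    · rintro ⟨P, K, f, g, w, hP, hK, hT⟩
      refine ext1 h.isoB (extB h) _ n (by push_cast; ring) _ hT ((ih K).1 hK) ?_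
      exact monoB' h ((inSh_zero h.isoB P).2 hP) (by omega)
    · intro hM
      obtain ⟨b, a, f, g, w, hb, ha, hT, -⟩ := decL h M
      refine ⟨b, a, f, g, w, hb, (ih a).2 ?_, hT⟩
      refine ext3 h.isoB (extB h) _ _ (by push_cast; ring) _ hT hM ?_
      exact monoB' h ((inSh_zero h.isoB b).2 hb) (by omega)

lemma epsHatA_iff (h : IsCotStructure Set.univ A B) (n : ℕ) (M : C) :
    M ∈ epsHat A n ↔ inSh A (-n) M := by
  induction n generalizing M with
  | zero =>
    rw [Nat.cast_zero, neg_zero]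
    exact (inSh_zero h.isoA M).symm
  | succ n ih =>
    constructor
    · rintro ⟨P, K, f, g, w, hP, hK, hT⟩
      refine ext3 h.isoA (extA h) _ (-n) (by push_cast; ring) _ hT ((ih P).1 hP) ?_
      exact monoA' h ((inSh_zero h.isoA K).2 hK) (by omega)
    · intro hM
      obtain ⟨b, a, f, g, w, hb, ha, hT, -⟩ := decR h M
      refine ⟨b, a, f, g, w, (ih b).2 ?_, ha, hT⟩
      refine ext1 h.isoA (extA h) _ _ (by push_cast; ring) _ hT hM ?_
      exact monoA' h ((inSh_zero h.isoA a).2 ha) (by omega)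

lemma epsCheckW (h : IsCotStructure Set.univ A B) (n : ℕ) (M : C) (hA : M ∈ A)
    (hM : inSh B n M) : M ∈ epsCheck (A ∩ B) n := by
  induction n generalizing M with
  | zero => exact ⟨hA, (inSh_zero h.isoB M).1 hM⟩
  | succ n ih =>
    obtain ⟨b, a, f, g, w, hb, ha, hT, hh⟩ := decL h M
    refine ⟨b, a, f, g, w, ⟨hh hA, hb⟩, ih a ha ?_, hT⟩
    refine ext3 h.isoB (extB h) _ _ (by push_cast; ring) _ hT hM ?_
    exact monoB' h ((inSh_zero h.isoB b).2 hb) (by omega)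

lemma epsHatW (h : IsCotStructure Set.univ A B) (n : ℕ) (M : C) (hB : M ∈ B)
    (hM : inSh A (-n) M) : M ∈ epsHat (A ∩ B) n := by
  induction n generalizing M with
  | zero => exact ⟨(inSh_zero h.isoA M).1 (by simpa using hM), hB⟩
  | succ n ih =>
    obtain ⟨b, a, f, g, w, hb, ha, hT, hh⟩ := decR h M
    refine ⟨b, a, f, g, w, ih b hb ?_, ⟨ha, hh hB⟩, hT⟩
    refine ext1 h.isoA (extA h) _ _ (by push_cast; ring) _ hT hM ?_
    exact monoA' h ((inSh_zero h.isoA a).2 ha) (by omega)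

lemma existsB (h : IsCotStructure Set.univ A B) (hbddB : (⋃ n : ℤ, shf B n) = Set.univ) (M : C) :
    ∃ n : ℕ, inSh B n M := by
  have : M ∈ ⋃ n : ℤ, shf B n := by rw [hbddB]; trivial
  obtain ⟨k, hk⟩ := Set.mem_iUnion.1 this
  exact ⟨(-k).toNat, monoB' h ((mem_shf h.isoB M k (-k) (by omega)).1 hk) (by omega)⟩

lemma existsA (h : IsCotStructure Set.univ A B) (hbddA : (⋃ n : ℤ, shf A n) = Set.univ) (M : C) :
    ∃ n : ℕ, inSh A (-n) M := by
  have : M ∈ ⋃ n : ℤ, shf A n := by rw [hbddA]; trivial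
  obtain ⟨k, hk⟩ := Set.mem_iUnion.1 this
  exact ⟨k.toNat, monoA' h ((mem_shf h.isoA M k (-k) (by omega)).1 hk) (by omega)⟩

lemma orthB (h : IsCotStructure Set.univ A B) {M a : C} {m i : ℤ} (hM : inSh B m M) (hi : m < i)
    (ha : a ∈ A) (f : a ⟶ M⟦i⟧) : f = 0 := by
  refine (shift_zero_iff a M 1 (i-1) i (by omega)).2 ?_ f
  intro g
  refine cot_orth h ?_ (monoB' h hM (by omega)) g
  exact (inSh_shift h.isoA a (-1) 1 0 (by omega)).2 ((inSh_zero h.isoA a).2 ha)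

lemma orthA (h : IsCotStructure Set.univ A B) {M b : C} {m i : ℤ} (hM : inSh A (-m) M) (hi : m < i)
    (hb : b ∈ B) (f : M⟦-i⟧ ⟶ b) : f = 0 := by
  refine cot_orth h ?_ hb f
  exact (inSh_shift h.isoA M (-i) 1 (-i+1) (by omega)).2 (monoA' h hM (by omega))

lemma inShB_of (h : IsCotStructure Set.univ A B) (M : C) (m : ℤ)
    (hM : ∀ a ∈ A, ∀ f : a ⟶ M⟦m+1⟧, f = 0) : inSh B m M := by
  apply memB h
  intro a ha
  have := (shift_zero_iff (a⟦(1:ℤ)⟧) M 1 m (m+1) rfl).1 (hM _ ha)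
  let e : (a⟦(1:ℤ)⟧)⟦(-1:ℤ)⟧ ≅ a :=
    ((shiftFunctorAdd' C 1 (-1) 0 (by omega)).symm.app a) ≪≫ (shiftFunctorZero C ℤ).app a
  intro f
  rw [← cancel_epi e.hom, this (e.hom ≫ f), comp_zero]

lemma inShA_of (h : IsCotStructure Set.univ A B) (M : C) (m : ℤ)
    (hM : ∀ b ∈ B, ∀ f : M⟦-(m+1)⟧ ⟶ b, f = 0) : inSh A (-m) M :=
  (inSh_shift h.isoA M (-(m+1)) 1 (-m) (by omega)).1 (memA h _ hM)

lemma inShB_of_w (h : IsCotStructure Set.univ A B) (hbddB : (⋃ n : ℤ, shf B n) = Set.univ)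
    (M : C) (m : ℕ)
    (hM : ∀ i : ℤ, (m : ℤ) < i → ∀ a ∈ A ∩ B, ∀ f : a ⟶ M⟦i⟧, f = 0) : inSh B m M := by
  obtain ⟨n, hn⟩ := existsB h hbddB M
  have key : ∀ k : ℕ, inSh B ((m : ℤ) + k) M → inSh B m M := by
    intro k
    induction k with
    | zero => intro hk; simpa using hk
    | succ k ih =>
      intro hk
      apply ih
      apply inShB_of h
      intro a ha f
      obtain ⟨b, a', u, v, w, hb, ha', hT, hh⟩ := decL h a
      have hT' := inv_rot_of_distTriang _ hT
      have hk' : M⟦(m:ℤ) + k + 1⟧ ∈ B := by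
        have : inSh B ((m:ℤ) + k + 1) M := monoB' h hk (by push_cast; omega)
        exact this
      obtain ⟨r, hr⟩ := Triangle.yoneda_exact₂ _ hT' f (cot_orth h
        ((inSh_shift h.isoA a' (-1) 1 0 (by omega)).2 ((inSh_zero h.isoA a').2 ha')) hk' _)
      rw [hr]
      exact (congrArg _ (hM _ (by omega) b ⟨hh ha, hb⟩ r)).trans comp_zero
  exact key n (monoB' h hn (by omega))

lemma inShA_of_w (h : IsCotStructure Set.univ A B) (hbddA : (⋃ n : ℤ, shf A n) = Set.univ)
    (M : C) (m : ℕ)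
    (hM : ∀ i : ℤ, (m : ℤ) < i → ∀ b ∈ A ∩ B, ∀ f : M⟦-i⟧ ⟶ b, f = 0) : inSh A (-m) M := by
  obtain ⟨n, hn⟩ := existsA h hbddA M
  have key : ∀ k : ℕ, inSh A (-((m : ℤ) + k)) M → inSh A (-m) M := by
    intro k
    induction k with
    | zero => intro hk; simpa using hk
    | succ k ih =>
      intro hk
      apply ih
      apply inShA_of h
      intro b hb f
      obtain ⟨b', a, u, v, w, hb', ha, hT, hh⟩ := decR h b
      have hk' : M⟦-((m:ℤ) + k + 1)⟧ ∈ A := by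
        have : inSh A (-((m:ℤ) + k + 1)) M := monoA' h hk (by push_cast; omega)
        exact this
      obtain ⟨r, hr⟩ := Triangle.coyoneda_exact₂ _ (rot_of_distTriang _ hT) f
        (orthB h ((inSh_zero h.isoB b').2 hb') one_pos hk' _)
      rw [hr]
      exact (congrArg (· ≫ _) (hM _ (by omega) a ⟨ha, hh hb⟩ r)).trans zero_comp
  exact key n (monoA' h hn (by omega))

lemma sInf_lt_top_of {P : ℕ → Prop} {n : ℕ} (hn : P n) :
    sInf {x : ℕ∞ | ∃ m : ℕ, x = (m : ℕ∞) ∧ P m} < ⊤ :=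
  lt_of_le_of_lt (sInf_le ⟨n, rfl, hn⟩) (ENat.natCast_lt_top n)

lemma sInf_congr_of {P Q : ℕ → Prop} (hPQ : ∀ n, P n ↔ Q n) :
    sInf {x : ℕ∞ | ∃ m : ℕ, x = (m : ℕ∞) ∧ P m} = sInf {x : ℕ∞ | ∃ m : ℕ, x = (m : ℕ∞) ∧ Q m} := by
  simp only [hPQ]

end helpers

/-- Let `(A, B)` be a bounded co-t-structure on `T` and `ω := A ∩ B`.
Then: (a) `Δ̄_T(ω) = (ω^∧)^∨ = (ω^∨)^∧ = T`, `U_ω = ω^∧ = B` and `_ωU = ω^∨ = A`;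
(b) `id_A(C) = id_ω(C) = coresdim_B(C) < ∞` for all `C`;
(c) `pd_B(C) = pd_ω(C) = resdim_A(C) < ∞` for all `C`;
(d) `coresdim_B(C) = coresdim_ω(C) < ∞` for all `C ∈ A`;
(e) `resdim_A(C) = resdim_ω(C) < ∞` for all `C ∈ B`. -/
theorem stmt9 (A B : Set C) (h : IsCotStructure Set.univ A B)
    (hbddA : (⋃ n : ℤ, shf A n) = Set.univ)
    (hbddB : (⋃ n : ℤ, shf B n) = Set.univ) :
    (thickClosure (A ∩ B) = check (hat (A ∩ B)) ∧
      check (hat (A ∩ B)) = hat (check (A ∩ B)) ∧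
      hat (check (A ∩ B)) = Set.univ ∧
      uPlus (A ∩ B) = hat (A ∩ B) ∧ hat (A ∩ B) = B ∧
      uMinus (A ∩ B) = check (A ∩ B) ∧ check (A ∩ B) = A) ∧
    (∀ M : C, idDim A M = idDim (A ∩ B) M ∧
      idDim (A ∩ B) M = coresdim B M ∧ coresdim B M < ⊤) ∧
    (∀ M : C, pdDim B M = pdDim (A ∩ B) M ∧
      pdDim (A ∩ B) M = resdim A M ∧ resdim A M < ⊤) ∧
    (∀ M ∈ A, coresdim B M = coresdim (A ∩ B) M ∧ coresdim (A ∩ B) M < ⊤) ∧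
    (∀ M ∈ B, resdim A M = resdim (A ∩ B) M ∧ resdim (A ∩ B) M < ⊤) := by
  have hcheckA : check (A ∩ B) = A := by
    apply Set.Subset.antisymm
    · exact Set.iUnion_subset fun n => epsCheck_sub_cosusp Set.inter_subset_left (cosuspA h) n
    · intro M hM
      obtain ⟨n, hn⟩ := existsB h hbddB M
      exact Set.mem_iUnion.2 ⟨n, epsCheckW h n M hM hn⟩
  have hhatB : hat (A ∩ B) = B := by
    apply Set.Subset.antisymm
    · exact Set.iUnion_subset fun n => epsHat_sub_susp Set.inter_subset_right (suspB h) n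
    · intro M hM
      obtain ⟨n, hn⟩ := existsA h hbddA M
      exact Set.mem_iUnion.2 ⟨n, epsHatW h n M hM hn⟩
  have hcB : check B = Set.univ := by
    refine Set.eq_univ_of_forall fun M => ?_
    obtain ⟨n, hn⟩ := existsB h hbddB M
    exact Set.mem_iUnion.2 ⟨n, (epsCheckB_iff h n M).2 hn⟩
  have hhA : hat A = Set.univ := by
    refine Set.eq_univ_of_forall fun M => ?_
    obtain ⟨n, hn⟩ := existsA h hbddA M
    exact Set.mem_iUnion.2 ⟨n, (epsHatA_iff h n M).2 hn⟩
  refine ⟨⟨?_, ?_, ?_, ?_, hhatB, ?_, hcheckA⟩, ?_, ?_, ?_, ?_⟩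
  · rw [hhatB, hcB]
    refine Set.eq_univ_of_forall fun M => ?_
    rintro S ⟨hS, hsub⟩
    have hBS : B ⊆ S := by
      rw [← hhatB]
      exact Set.iUnion_subset fun n => epsHat_sub_susp hsub ⟨hS.shift 1, hS.ext⟩ n
    obtain ⟨n, hn⟩ := existsB h hbddB M
    exact hS.shift (-n) ((mem_shf hS.iso M (-n) n (by omega)).2 (hBS hn))
  · rw [hhatB, hcB, hcheckA, hhA]
  · rw [hcheckA, hhA]
  · apply Set.Subset.antisymm
    · rw [hhatB]
      exact Set.sInter_subset_of_mem ⟨suspB h, Set.inter_subset_right⟩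
    · rintro M hM S ⟨hS, hsub⟩
      exact Set.iUnion_subset (fun n => epsHat_sub_susp hsub hS n) hM
  · apply Set.Subset.antisymm
    · rw [hcheckA]
      exact Set.sInter_subset_of_mem ⟨cosuspA h, Set.inter_subset_left⟩
    · rintro M hM S ⟨hS, hsub⟩
      exact Set.iUnion_subset (fun n => epsCheck_sub_cosusp hsub hS n) hM
  · intro M
    refine ⟨sInf_congr_of fun n => ⟨fun hn i hi a ha f => hn i hi a ha.1 f, fun hn i hi a ha f =>
      orthB h (inShB_of_w h hbddB M n hn) hi ha f⟩, sInf_congr_of fun n => ?_, ?_⟩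
    · rw [epsCheckB_iff h]
      exact ⟨inShB_of_w h hbddB M n, fun hn i hi a ha f => orthB h hn hi ha.1 f⟩
    · obtain ⟨n, hn⟩ := existsB h hbddB M
      exact sInf_lt_top_of ((epsCheckB_iff h n M).2 hn)
  · intro M
    refine ⟨sInf_congr_of fun n => ⟨fun hn i hi a ha f => hn i hi a ha.2 f, fun hn i hi a ha f =>
      orthA h (inShA_of_w h hbddA M n hn) hi ha f⟩, sInf_congr_of fun n => ?_, ?_⟩
    · rw [epsHatA_iff h]
      exact ⟨inShA_of_w h hbddA M n, fun hn i hi a ha f => orthA h hn hi ha.2 f⟩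
    · obtain ⟨n, hn⟩ := existsA h hbddA M
      exact sInf_lt_top_of ((epsHatA_iff h n M).2 hn)
  · intro M hM
    refine ⟨sInf_congr_of fun n => ⟨fun hn => epsCheckW h n M hM ((epsCheckB_iff h n M).1 hn),
      fun hn => epsCheck_mono Set.inter_subset_right n hn⟩, ?_⟩
    obtain ⟨n, hn⟩ := existsB h hbddB M
    exact sInf_lt_top_of (epsCheckW h n M hM hn)
  · intro M hM
    refine ⟨sInf_congr_of fun n => ⟨fun hn => epsHatW h n M hM ((epsHatA_iff h n M).1 hn),
      fun hn => epsHat_mono Set.inter_subset_left n hn⟩, ?_⟩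
    obtain ⟨n, hn⟩ := existsA h hbddA M
    exact sInf_lt_top_of (epsHatW h n M hM hn)

end CotPaper
end

section
/- Let (X, Y) be a co-t-structure on a triangulated category T. Then the following are equivalent: (1) (X, Y) is bounded; (2) (X, Y) is faithful; (3) (X, Y) is bounded and non-degenerate; (4) T = Δ̄_T(X ∩ Y). -/
open CategoryTheory CategoryTheory.Limits CategoryTheory.Pretriangulated

universe v u

variable (C : Type u) [Category.{v} C] [HasZeroObject C] [HasShift C ℤ]
  [Preadditive C] [∀ n : ℤ, (CategoryTheory.shiftFunctor C n).Additive]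
  [Pretriangulated C]

namespace CotPaper

variable {C}

lemma shf_iso_s10 {X : Set C} {a : ℤ} {Z W : C} (hZ : Z ∈ shf X a) (e : Z ≅ W) : W ∈ shf X a := by
  obtain ⟨A, hA, ⟨i⟩⟩ := hZ
  exact ⟨A, hA, ⟨e.symm ≪≫ i⟩⟩

lemma shf_shift {X : Set C} {a : ℤ} {Z : C} (n b : ℤ) (hb : a + n = b) (hZ : Z ∈ shf X a) :
    Z⟦n⟧ ∈ shf X b := by
  obtain ⟨A, hA, ⟨i⟩⟩ := hZ
  exact ⟨A, hA, ⟨(shiftFunctor C n).mapIso i ≪≫ ((shiftFunctorAdd' C a n b hb).app A).symm⟩⟩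

lemma shf_unshift {X : Set C} {b : ℤ} {Z : C} (n a : ℤ) (hb : a + n = b) (hZ : Z⟦n⟧ ∈ shf X b) :
    Z ∈ shf X a :=
  shf_iso_s10 (shf_shift (-n) a (by omega) hZ)
    ((shiftFunctorCompIsoId C n (-n) (by omega)).app Z)

lemma mem_shf_zero {X : Set C} {Z : C} (hZ : Z ∈ X) : Z ∈ shf X 0 :=
  ⟨Z, hZ, ⟨((shiftFunctorZero C ℤ).app Z).symm⟩⟩

lemma of_shf_zero {X : Set C} (hX : isoClosed X) {Z : C} (hZ : Z ∈ shf X 0) : Z ∈ X := by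
  obtain ⟨A, hA, ⟨i⟩⟩ := hZ
  exact hX hA (i ≪≫ (shiftFunctorZero C ℤ).app A).symm

lemma shf_summand {X : Set C} (hi : isoClosed X) (hX : summandClosed X) (a : ℤ) :
    summandClosed (shf X a) := by
  rintro W Z hW ⟨i, r, hir⟩
  refine shf_unshift (-a) a (b := 0) (by omega) (mem_shf_zero (hX (of_shf_zero hi
    (shf_shift (-a) 0 (by omega) hW)) ⟨i⟦-a⟧', r⟦-a⟧', ?_⟩))
  rw [← Functor.map_comp, hir, CategoryTheory.Functor.map_id]

lemma eq_zero_of_shift {Z W : C} (n : ℤ) (f : Z ⟶ W) (hf : f⟦n⟧' = 0) : f = 0 :=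
  (shiftFunctor C n).map_injective (by rw [hf, Functor.map_zero])

section
variable {X Y : Set C} (h : IsCotStructure Set.univ X Y)
include h

lemma monoX {a b : ℤ} (hab : a ≤ b) : shf X a ⊆ shf X b := by
  obtain ⟨k, rfl⟩ := Int.le.dest hab
  induction k with
  | zero => simp
  | succ k ih =>
    refine (ih (by omega)).trans fun Z hZ => ?_
    have h1 := h.shiftA (of_shf_zero (X := shf X (-1)) (fun _ _ hA e => shf_iso_s10 hA e)
      (mem_shf_zero (shf_shift (-(a + k) - 1) (-1) (by omega) hZ)))
    exact shf_unshift (-(a + k) - 1) _ (b := 0) (by push_cast; omega) (mem_shf_zero h1)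

lemma monoY {a b : ℤ} (hab : a ≤ b) : shf Y b ⊆ shf Y a := by
  obtain ⟨k, rfl⟩ := Int.le.dest hab
  induction k with
  | zero => simp
  | succ k ih =>
    refine Set.Subset.trans (fun Z hZ => ?_) (ih (by omega))
    have h1 := h.shiftB (shf_shift (-(a + k)) 1 (by push_cast; omega) hZ)
    exact shf_unshift (-(a + k)) _ (b := 0) (by omega) (mem_shf_zero h1)

lemma orth' {a b : ℤ} (hab : a < b) {Z W : C} (hZ : Z ∈ shf X a) (hW : W ∈ shf Y b)
    (f : Z ⟶ W) : f = 0 := by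
  apply eq_zero_of_shift (-b)
  exact h.orth _ (shf_shift (-b) (-1) (by omega) (monoX h (show a ≤ b - 1 by omega) hZ)) _
    (of_shf_zero h.isoB (shf_shift (-b) 0 (by omega) hW)) _

lemma charX (a : ℤ) {Z : C} (hZ : ∀ W ∈ shf Y (a + 1), ∀ f : Z ⟶ W, f = 0) : Z ∈ shf X a := by
  refine shf_unshift (-(a + 1)) a (b := -1) (by omega) ?_
  obtain ⟨A, B, f, g, k, hA, hB, hT⟩ : Z⟦-(a + 1)⟧ ∈ star (shf X (-1)) Y := by
    rw [← h.decomp]; trivial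
  have hg : g = 0 := by
    let e := (shiftFunctorCompIsoId C (-(a + 1)) (a + 1) (by omega)).app Z
    apply eq_zero_of_shift (a + 1)
    have := hZ _ (shf_shift (a + 1) (a + 1) (by omega) (mem_shf_zero hB)) (e.inv ≫ g⟦a + 1⟧')
    rw [← cancel_epi e.inv, this, comp_zero]
  obtain ⟨s, hs⟩ := Triangle.coyoneda_exact₂ _ hT (𝟙 (Z⟦-(a + 1)⟧)) (by
    change _ ≫ g = 0
    rw [hg, comp_zero])
  exact shf_summand h.isoA h.summandA _ hA ⟨s, f, hs.symm⟩

lemma charY (a : ℤ) {Z : C} (hZ : ∀ W ∈ shf X (a - 1), ∀ f : W ⟶ Z, f = 0) : Z ∈ shf Y a := by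
  refine shf_unshift (-a) a (b := 0) (by omega) (mem_shf_zero ?_)
  obtain ⟨A, B, f, g, k, hA, hB, hT⟩ : Z⟦-a⟧ ∈ star (shf X (-1)) Y := by
    rw [← h.decomp]; trivial
  have hf : f = 0 := by
    let e := (shiftFunctorCompIsoId C (-a) a (by omega)).app Z
    apply eq_zero_of_shift a
    have := hZ _ (shf_shift a (a - 1) (by omega) hA) (f⟦a⟧' ≫ e.hom)
    rw [← cancel_mono e.hom, this, zero_comp]
  obtain ⟨s, hs⟩ := Triangle.yoneda_exact₂ _ hT (𝟙 (Z⟦-a⟧)) (by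
    change f ≫ _ = 0
    rw [hf, zero_comp])
  exact h.summandB hB ⟨g, s, hs.symm⟩

lemma extX (a : ℤ) (T : Triangle C) (hT : T ∈ distTriang C) (h1 : T.obj₁ ∈ shf X a)
    (h3 : T.obj₃ ∈ shf X a) : T.obj₂ ∈ shf X a := by
  refine charX h a fun W hW f => ?_
  obtain ⟨s, rfl⟩ := Triangle.yoneda_exact₂ T hT f (orth' h (by omega) h1 hW _)
  rw [orth' h (by omega) h3 hW s, comp_zero]

lemma extY (a : ℤ) (T : Triangle C) (hT : T ∈ distTriang C) (h1 : T.obj₁ ∈ shf Y a)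
    (h3 : T.obj₃ ∈ shf Y a) : T.obj₂ ∈ shf Y a := by
  refine charY h a fun W hW f => ?_
  obtain ⟨s, rfl⟩ := Triangle.coyoneda_exact₂ T hT f (orth' h (by omega) hW h3 _)
  rw [orth' h (by omega) hW h1 s, zero_comp]

lemma zeroX (a : ℤ) {Z : C} (hZ : IsZero Z) : Z ∈ shf X a :=
  charX h a fun _ _ f => hZ.eq_of_src f 0

lemma zeroY (a : ℤ) {Z : C} (hZ : IsZero Z) : Z ∈ shf Y a :=
  charY h a fun _ _ f => hZ.eq_of_tgt f 0

lemma thickX : IsThick (⋃ n : ℤ, shf X n) where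
  zero := ⟨_, Set.mem_iUnion.2 ⟨0, zeroX h 0 (isZero_zero C)⟩, isZero_zero C⟩
  iso := by
    intro A B hA e
    obtain ⟨n, hn⟩ := Set.mem_iUnion.1 hA
    exact Set.mem_iUnion.2 ⟨n, shf_iso_s10 hn e⟩
  shift := by
    rintro n Z ⟨A, hA, ⟨e⟩⟩
    obtain ⟨m, hm⟩ := Set.mem_iUnion.1 hA
    exact Set.mem_iUnion.2 ⟨_, shf_iso_s10 (shf_shift n _ rfl hm) e.symm⟩
  ext := by
    rintro Z ⟨A, B, f, g, k, hA, hB, hT⟩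
    obtain ⟨m, hm⟩ := Set.mem_iUnion.1 hA
    obtain ⟨n, hn⟩ := Set.mem_iUnion.1 hB
    exact Set.mem_iUnion.2 ⟨max m n, extX h _ _ hT (monoX h (le_max_left m n) hm)
      (monoX h (le_max_right m n) hn)⟩
  summand := by
    intro W Z hW hs
    obtain ⟨m, hm⟩ := Set.mem_iUnion.1 hW
    exact Set.mem_iUnion.2 ⟨m, shf_summand h.isoA h.summandA m hm hs⟩

lemma thickY : IsThick (⋃ n : ℤ, shf Y n) where
  zero := ⟨_, Set.mem_iUnion.2 ⟨0, zeroY h 0 (isZero_zero C)⟩, isZero_zero C⟩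
  iso := by
    intro A B hA e
    obtain ⟨n, hn⟩ := Set.mem_iUnion.1 hA
    exact Set.mem_iUnion.2 ⟨n, shf_iso_s10 hn e⟩
  shift := by
    rintro n Z ⟨A, hA, ⟨e⟩⟩
    obtain ⟨m, hm⟩ := Set.mem_iUnion.1 hA
    exact Set.mem_iUnion.2 ⟨_, shf_iso_s10 (shf_shift n _ rfl hm) e.symm⟩
  ext := by
    rintro Z ⟨A, B, f, g, k, hA, hB, hT⟩
    obtain ⟨m, hm⟩ := Set.mem_iUnion.1 hA
    obtain ⟨n, hn⟩ := Set.mem_iUnion.1 hB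
    exact Set.mem_iUnion.2 ⟨min m n, extY h _ _ hT (monoY h (min_le_left m n) hm)
      (monoY h (min_le_right m n) hn)⟩
  summand := by
    intro W Z hW hs
    obtain ⟨m, hm⟩ := Set.mem_iUnion.1 hW
    exact Set.mem_iUnion.2 ⟨m, shf_summand h.isoB h.summandB m hm hs⟩

lemma peel {S : Set C} (hS : IsThick S) (hω : X ∩ Y ⊆ S) (m : ℕ) :
    ∀ Z : C, Z ∈ shf X 0 → Z ∈ shf Y (-(m : ℤ)) → Z ∈ S := by
  induction m with
  | zero =>
    intro Z h1 h2
    exact hω ⟨of_shf_zero h.isoA h1, of_shf_zero h.isoB (by simpa using h2)⟩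
  | succ m ih =>
    intro Z h1 h2
    obtain ⟨A, B, f, g, k, hA, hB, hT⟩ : Z ∈ star (shf X (-1)) Y := by
      rw [← h.decomp]; trivial
    have hB0 := mem_shf_zero hB
    have hA1 : A⟦(1 : ℤ)⟧ ∈ shf X 0 := shf_shift 1 0 (by omega) hA
    have hBX : B ∈ shf X 0 := extX h 0 _ (rot_of_distTriang _ hT) h1 hA1
    have hAY : A ∈ shf Y (-((m + 1 : ℕ) : ℤ)) :=
      extY h _ _ (inv_rot_of_distTriang _ hT)
        (monoY h (by push_cast; omega) (shf_shift (-1) (-1) (by omega) hB0)) h2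
    have hAS : A⟦(1 : ℤ)⟧ ∈ S := ih _ hA1 (shf_shift 1 _ (by push_cast; omega) hAY)
    have hAS' : A ∈ S := hS.shift (-1) ⟨_, hAS,
      ⟨((shiftFunctorCompIsoId C (1 : ℤ) (-1) (by omega)).app A).symm⟩⟩
    exact hS.ext ⟨A, B, f, g, k, hAS', hω ⟨of_shf_zero h.isoA hBX, hB⟩, hT⟩

lemma bounded_thick {S : Set C} (hS : IsThick S) (hω : X ∩ Y ⊆ S) {a b : ℤ} {Z : C}
    (h1 : Z ∈ shf X a) (h2 : Z ∈ shf Y b) : Z ∈ S := by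
  have h3 : Z⟦-a⟧ ∈ S := peel h hS hω (a - b).toNat _ (shf_shift (-a) 0 (by omega) h1)
    (monoY h (by omega) (shf_shift (-a) (b - a) (by omega) h2))
  exact hS.shift a ⟨_, h3, ⟨((shiftFunctorCompIsoId C (-a) a (by omega)).app Z).symm⟩⟩

end

/-- For a co-t-structure `(X, Y)` on `T`, the following are equivalent:
(1) `(X, Y)` is bounded; (2) `(X, Y)` is faithful; (3) `(X, Y)` is bounded and
non-degenerate; (4) `T = Δ̄_T(X ∩ Y)`. -/
theorem stmt10 (X Y : Set C) (h : IsCotStructure Set.univ X Y) :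
    [((⋃ n : ℤ, shf X n) = Set.univ ∧ (⋃ n : ℤ, shf Y n) = Set.univ),
     ((⋃ n : ℤ, shf X n) = thickClosure (X ∩ Y) ∧
       (⋃ n : ℤ, shf Y n) = thickClosure (X ∩ Y)),
     (((⋃ n : ℤ, shf X n) = Set.univ ∧ (⋃ n : ℤ, shf Y n) = Set.univ) ∧
       ((⋂ i : ℤ, shf X i) = {Z : C | IsZero Z} ∧
         (⋂ i : ℤ, shf Y i) = {Z : C | IsZero Z})),
     (Set.univ : Set C) = thickClosure (X ∩ Y)].TFAE := by
  have h14 : ((⋃ n : ℤ, shf X n) = Set.univ ∧ (⋃ n : ℤ, shf Y n) = Set.univ) →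
      (Set.univ : Set C) = thickClosure (X ∩ Y) := by
    rintro ⟨h1, h2⟩
    symm
    refine Set.eq_univ_of_forall fun Z => ?_
    rintro S ⟨hS, hω⟩
    obtain ⟨a, ha⟩ := Set.mem_iUnion.1 (h1.symm ▸ Set.mem_univ Z)
    obtain ⟨b, hb⟩ := Set.mem_iUnion.1 (h2.symm ▸ Set.mem_univ Z)
    exact bounded_thick h hS hω ha hb
  have h41 : (Set.univ : Set C) = thickClosure (X ∩ Y) →
      ((⋃ n : ℤ, shf X n) = Set.univ ∧ (⋃ n : ℤ, shf Y n) = Set.univ) := by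
    intro h4
    constructor
    · refine Set.eq_univ_of_forall fun Z => ?_
      have hZ : Z ∈ thickClosure (X ∩ Y) := h4 ▸ Set.mem_univ Z
      exact hZ _ ⟨thickX h, fun W hW => Set.mem_iUnion.2 ⟨0, mem_shf_zero hW.1⟩⟩
    · refine Set.eq_univ_of_forall fun Z => ?_
      have hZ : Z ∈ thickClosure (X ∩ Y) := h4 ▸ Set.mem_univ Z
      exact hZ _ ⟨thickY h, fun W hW => Set.mem_iUnion.2 ⟨0, mem_shf_zero hW.2⟩⟩
  tfae_have 1 → 4 := h14
  tfae_have 4 → 1 := h41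
  tfae_have 3 → 1 := fun h3 => h3.1
  tfae_have 1 → 2 := fun h1 => ⟨h1.1.trans (h14 h1), h1.2.trans (h14 h1)⟩
  tfae_have 2 → 4 := by
    rintro ⟨h1, h2⟩
    symm
    refine Set.eq_univ_of_forall fun Z => ?_
    obtain ⟨A, B, f, g, k, hA, hB, hT⟩ : Z ∈ star (shf X (-1)) Y := by
      rw [← h.decomp]; trivial
    have hA' : A ∈ thickClosure (X ∩ Y) := h1 ▸ Set.mem_iUnion.2 ⟨_, hA⟩
    have hB' : B ∈ thickClosure (X ∩ Y) := h2 ▸ Set.mem_iUnion.2 ⟨0, mem_shf_zero hB⟩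
    intro S hS
    exact hS.1.ext ⟨A, B, f, g, k, hA' S hS, hB' S hS, hT⟩
  tfae_have 1 → 3 := by
    rintro ⟨h1, h2⟩
    refine ⟨⟨h1, h2⟩, ?_, ?_⟩
    · ext Z
      refine ⟨fun hZ => ?_, fun hZ => Set.mem_iInter.2 fun i => zeroX h i hZ⟩
      obtain ⟨b, hb⟩ := Set.mem_iUnion.1 (h2.symm ▸ Set.mem_univ Z)
      exact (IsZero.iff_id_eq_zero Z).2
        (orth' h (show b - 1 < b by omega) (Set.mem_iInter.1 hZ _) hb _)
    · ext Z
      refine ⟨fun hZ => ?_, fun hZ => Set.mem_iInter.2 fun i => zeroY h i hZ⟩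
      obtain ⟨b, hb⟩ := Set.mem_iUnion.1 (h1.symm ▸ Set.mem_univ Z)
      exact (IsZero.iff_id_eq_zero Z).2
        (orth' h (show b < b + 1 by omega) hb (Set.mem_iInter.1 hZ _) _)
  tfae_finish

end CotPaper
end
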